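/- Let K be a number field, let r be a natural number, let u₁, …, u_r ∈ Kˣ be multiplicatively independent modulo squares (whenever e₁, …, e_r ∈ {0,1} satisfy that u₁^{e₁}⋯u_r^{e_r} is a square in K, all e_i = 0), and let u₀ ∈ Kˣ. Then there exist nonzero prime ideals v₁, …, v_r of 𝓞_K and group homomorphisms λ_i : (K_{v_i})ˣ → ℤ/2ℤ such that the map sending (e₁,…,e_r) ∈ {0,1}^r to the tuple (λ_i(image of u₀·u₁^{e₁}⋯u_r^{e_r} in K_{v_i}))_{i=1,…,r} ∈ (ℤ/2ℤ)^r is injective. In other words, the 2^r candidates in the affine coset {u₀·u₁^{e₁}⋯u_r^{e_r}} modulo squares are uniquely determined by r local bits. -/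

import Mathlib

open IsDedekindDomain NumberField

open Filter Topology UniqueFactorizationMonoid

namespace IsDedekindDomain.HeightOneSpectrum

variable {R S : Type*} [CommRing R] [IsDedekindDomain R] [CommRing S] [IsDedekindDomain S]

theorem prod_map_asIdeal_injective :
    Function.Injective fun s : Multiset (HeightOneSpectrum R) ↦ (s.map asIdeal).prod := by
  intro s t h
  have key (s : Multiset (HeightOneSpectrum R)) :
      normalizedFactors (s.map asIdeal).prod = s.map asIdeal := by
    apply normalizedFactors_prod_of_prime
    simp only [Multiset.mem_map]
    rintro _ ⟨v, -, rfl⟩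
    exact v.prime
  exact Multiset.map_injective (fun _ _ ↦ HeightOneSpectrum.ext) <| by
    rw [← key s, ← key t]; exact congrArg _ h

theorem exists_prod_map_asIdeal_eq {I : Ideal R} (hI : I ≠ 0) :
    ∃ s : Multiset (HeightOneSpectrum R), (s.map asIdeal).prod = I := by
  induction I using induction_on_prime with
  | h₁ => exact absurd rfl hI
  | h₂ I hu => exact ⟨0, by simp [isUnit_iff_eq_one.mp hu]⟩
  | h₃ I p hI' hp ih =>
    obtain ⟨s, rfl⟩ := ih hI'
    exact ⟨⟨p, Ideal.isPrime_of_prime hp, hp.ne_zero⟩ ::ₘ s, by simp⟩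

end IsDedekindDomain.HeightOneSpectrum

theorem Multiset.map_add_map_inj {α β : Type*} {f g : α → β} (hf : Function.Injective f)
    (hg : Function.Injective g) (hfg : ∀ a b, f a ≠ g b) {s s' t t' : Multiset α}
    (h : s.map f + t.map g = s'.map f + t'.map g) : s = s' ∧ t = t' := by
  classical
  constructor <;> ext a
  · have := congrArg (Multiset.count (f a)) h
    have hz (t : Multiset α) : Multiset.count (f a) (t.map g) = 0 :=
      Multiset.count_eq_zero.mpr fun hm ↦ by
        obtain ⟨b, -, hb⟩ := Multiset.mem_map.mp hm
        exact hfg a b hb.symm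
    simpa [hz, Multiset.count_map_eq_count' f _ hf] using this
  · have := congrArg (Multiset.count (g a)) h
    have hz (t : Multiset α) : Multiset.count (g a) (t.map f) = 0 :=
      Multiset.count_eq_zero.mpr fun hm ↦ by
        obtain ⟨b, -, hb⟩ := Multiset.mem_map.mp hm
        exact hfg b a hb
    simpa [hz, Multiset.count_map_eq_count' g _ hg] using this

namespace NumberField

open HeightOneSpectrum

variable {K L : Type*} [Field K] [NumberField K] [Field L] [NumberField L]

theorem sum_card_absNorm_mul_card_absNorm_le
    (Q Q' : HeightOneSpectrum (𝓞 K) → HeightOneSpectrum (𝓞 L))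
    (hQ : Function.Injective Q) (hQ' : Function.Injective Q') (hQQ' : ∀ v w, Q v ≠ Q' w)
    (hN : ∀ v, Ideal.absNorm (Q v).asIdeal = Ideal.absNorm v.asIdeal)
    (hN' : ∀ v, Ideal.absNorm (Q' v).asIdeal = Ideal.absNorm v.asIdeal) (n : ℕ) :
    ∑ p ∈ n.divisorsAntidiagonal, Nat.card {I : Ideal (𝓞 K) // Ideal.absNorm I = p.1} *
      Nat.card {I : Ideal (𝓞 K) // Ideal.absNorm I = p.2} ≤
      Nat.card {I : Ideal (𝓞 L) // Ideal.absNorm I = n} := by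
  classical
  rcases eq_or_ne n 0 with rfl | hn
  · simp
  have hfin (m : ℕ) : Finite {I : Ideal (𝓞 K) // Ideal.absNorm I = m} :=
    Ideal.finite_setOfPred_absNorm_eq m
  have hfin' : Finite {I : Ideal (𝓞 L) // Ideal.absNorm I = n} :=
    Ideal.finite_setOfPred_absNorm_eq n
  have hex (I : Ideal (𝓞 K)) : ∃ s : Multiset (HeightOneSpectrum (𝓞 K)),
      I ≠ 0 → (s.map asIdeal).prod = I := by
    by_cases hI : I = 0
    · exact ⟨0, fun h ↦ absurd hI h⟩
    · exact (exists_prod_map_asIdeal_eq hI).imp fun _ h _ ↦ h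
  choose f hf using hex
  have hnorm (g : HeightOneSpectrum (𝓞 K) → HeightOneSpectrum (𝓞 L))
      (hg : ∀ v, Ideal.absNorm (g v).asIdeal = Ideal.absNorm v.asIdeal)
      (I : Ideal (𝓞 K)) (hI : I ≠ 0) :
      Ideal.absNorm (((f I).map g).map asIdeal).prod = Ideal.absNorm I := by
    conv_rhs => rw [← hf I hI]
    simp [map_multiset_prod, Multiset.map_map, hg]
  have hne {m : ℕ} (hm : m ≠ 0) (I : {I : Ideal (𝓞 K) // Ideal.absNorm I = m}) : I.1 ≠ 0 := by
    rintro h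
    exact hm (by rw [← I.2, h]; simp)
  have hne₁ (p : n.divisorsAntidiagonal) : p.1.1 ≠ 0 :=
    Nat.ne_zero_of_mem_divisorsAntidiagonal p.2 |>.1
  have hne₂ (p : n.divisorsAntidiagonal) : p.1.2 ≠ 0 :=
    Nat.ne_zero_of_mem_divisorsAntidiagonal p.2 |>.2
  let F : (Σ p : n.divisorsAntidiagonal, {I : Ideal (𝓞 K) // Ideal.absNorm I = p.1.1} ×
      {I : Ideal (𝓞 K) // Ideal.absNorm I = p.1.2}) →
      {I : Ideal (𝓞 L) // Ideal.absNorm I = n} := fun x ↦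
    ⟨(((f x.2.1.1).map Q + (f x.2.2.1).map Q').map asIdeal).prod, by
      rw [Multiset.map_add, Multiset.prod_add, map_mul, hnorm Q hN _ (hne (hne₁ x.1) _),
        hnorm Q' hN' _ (hne (hne₂ x.1) _), x.2.1.2, x.2.2.2,
        (Nat.mem_divisorsAntidiagonal.mp x.1.2).1]⟩
  have hF : Function.Injective F := by
    rintro ⟨p, I, J⟩ ⟨p', I', J'⟩ h
    have h' := Multiset.map_add_map_inj hQ hQ' hQQ'
      (prod_map_asIdeal_injective (Subtype.ext_iff.mp h))
    have hI : I.1 = I'.1 := by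
      rw [← hf _ (hne (hne₁ p) I), ← hf _ (hne (hne₁ p') I'), h'.1]
    have hJ : J.1 = J'.1 := by
      rw [← hf _ (hne (hne₂ p) J), ← hf _ (hne (hne₂ p') J'), h'.2]
    obtain ⟨⟨a, b⟩, hp⟩ := p
    obtain ⟨⟨a', b'⟩, hp'⟩ := p'
    obtain ⟨I, hI₁⟩ := I
    obtain ⟨J, hJ₁⟩ := J
    obtain ⟨I', hI₁'⟩ := I'
    obtain ⟨J', hJ₁'⟩ := J'
    clear h h'
    cases hI
    cases hJ
    obtain rfl : a = a' := hI₁.symm.trans hI₁'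
    obtain rfl : b = b' := hJ₁.symm.trans hJ₁'
    rfl
  have := Nat.card_le_card_of_injective F hF
  rw [Nat.card_sigma] at this
  simp only [Nat.card_prod] at this
  rwa [Finset.sum_coe_sort n.divisorsAntidiagonal
    (fun p ↦ Nat.card {I : Ideal (𝓞 K) // Ideal.absNorm I = p.1} *
      Nat.card {I : Ideal (𝓞 K) // Ideal.absNorm I = p.2})] at this

variable (K) in
theorem eventually_LSeriesSummable_card_absNorm : ∀ᶠ s : ℝ in 𝓝[>] 1,
    LSeriesSummable (fun n ↦ (Nat.card {I : Ideal (𝓞 K) // Ideal.absNorm I = n} : ℂ)) s := by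
  have h := tendsto_sub_one_mul_dedekindZeta_nhdsGT K
  have h0 : (dedekindZeta_residue K : ℂ) ≠ 0 := by
    exact_mod_cast dedekindZeta_residue_ne_zero K
  filter_upwards [h.eventually_ne h0] with s hs
  by_contra hns
  exact hs (by rw [dedekindZeta, LSeries, tsum_eq_zero_of_not_summable hns, mul_zero])

theorem norm_LSeries_le_norm_LSeries {f g : ℕ → ℝ} (hf : ∀ n, 0 ≤ f n) (hfg : ∀ n, f n ≤ g n)
    {s : ℝ} (hg : LSeriesSummable (fun n ↦ (g n : ℂ)) s) :
    ‖LSeries (fun n ↦ (f n : ℂ)) s‖ ≤ ‖LSeries (fun n ↦ (g n : ℂ)) s‖ := by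
  have hterm (f : ℕ → ℝ) (hf : ∀ n, 0 ≤ f n) (n : ℕ) :
      LSeries.term (fun n ↦ (f n : ℂ)) s n = (‖LSeries.term (fun n ↦ (f n : ℂ)) s n‖ : ℝ) := by
    rcases eq_or_ne n 0 with rfl | hn
    · simp
    · rw [LSeries.term_of_ne_zero hn, ← Complex.ofReal_natCast,
        ← Complex.ofReal_cpow (by positivity),
        ← Complex.ofReal_div, Complex.norm_real, Real.norm_of_nonneg]
      exact div_nonneg (hf n) (by positivity)
  have hg' : ‖LSeries (fun n ↦ (g n : ℂ)) s‖ =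
      ∑' n, ‖LSeries.term (fun n ↦ (g n : ℂ)) s n‖ := by
    rw [LSeries, tsum_congr (hterm g fun n ↦ (hf n).trans (hfg n)), ← Complex.ofReal_tsum,
      Complex.norm_real, Real.norm_of_nonneg (tsum_nonneg fun _ ↦ norm_nonneg _)]
  rw [hg']
  refine tsum_of_norm_bounded hg.norm.hasSum fun n ↦ LSeries.norm_term_le _ ?_
  simpa [abs_of_nonneg (hf n), abs_of_nonneg ((hf n).trans (hfg n))] using hfg n

theorem not_exists_two_sections
    (Q Q' : HeightOneSpectrum (𝓞 K) → HeightOneSpectrum (𝓞 L))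
    (hQ : Function.Injective Q) (hQ' : Function.Injective Q') (hQQ' : ∀ v w, Q v ≠ Q' w)
    (hN : ∀ v, Ideal.absNorm (Q v).asIdeal = Ideal.absNorm v.asIdeal)
    (hN' : ∀ v, Ideal.absNorm (Q' v).asIdeal = Ideal.absNorm v.asIdeal) : False := by
  let a (n : ℕ) : ℝ := Nat.card {I : Ideal (𝓞 K) // Ideal.absNorm I = n}
  let b (n : ℕ) : ℝ := Nat.card {I : Ideal (𝓞 L) // Ideal.absNorm I = n}
  let c (n : ℕ) : ℝ := ∑ p ∈ n.divisorsAntidiagonal, a p.1 * a p.2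
  have hcb (n : ℕ) : c n ≤ b n := by
    simpa [a, b, c] using
      (Nat.cast_le (α := ℝ)).mpr (sum_card_absNorm_mul_card_absNorm_le Q Q' hQ hQ' hQQ' hN hN' n)
  have hc0 (n : ℕ) : 0 ≤ c n := by positivity
  have hle : ∀ᶠ s : ℝ in 𝓝[>] 1,
      ‖dedekindZeta K s‖ * ‖dedekindZeta K s‖ ≤ ‖dedekindZeta L s‖ := by
    filter_upwards [eventually_LSeriesSummable_card_absNorm K,
      eventually_LSeriesSummable_card_absNorm L] with s hK hL
    have hconv := LSeries_convolution' hK hK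
    rw [LSeries.convolution_def] at hconv
    rw [← norm_mul, dedekindZeta, dedekindZeta, ← hconv]
    simpa [b, c, a] using norm_LSeries_le_norm_LSeries (g := b) hc0 hcb (s := s)
      (by simpa [b] using hL)
  have hK := (tendsto_sub_one_mul_dedekindZeta_nhdsGT K).norm
  have hL := (tendsto_sub_one_mul_dedekindZeta_nhdsGT L).norm
  have hs : Tendsto (fun s : ℝ ↦ ‖(s - 1 : ℂ)‖) (𝓝[>] 1) (𝓝 0) := by
    have : Tendsto (fun s : ℝ ↦ ‖(s - 1 : ℂ)‖) (𝓝 1) (𝓝 ‖((1 : ℝ) - 1 : ℂ)‖) :=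
      Continuous.tendsto (by fun_prop) 1
    simpa using this.mono_left nhdsWithin_le_nhds
  have h := le_of_tendsto_of_tendsto (hK.mul hK) (hs.mul hL) (by
    filter_upwards [hle] with s h
    simp only [norm_mul]
    calc _ = ‖(s - 1 : ℂ)‖ * ‖(s - 1 : ℂ)‖ * (‖dedekindZeta K s‖ * ‖dedekindZeta K s‖) := by ring
      _ ≤ ‖(s - 1 : ℂ)‖ * ‖(s - 1 : ℂ)‖ * ‖dedekindZeta L s‖ := by gcongr
      _ = _ := by ring)
  have hpos : 0 < ‖(dedekindZeta_residue K : ℂ)‖ :=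
    norm_pos_iff.mpr (by exact_mod_cast dedekindZeta_residue_ne_zero K)
  have := mul_pos hpos hpos
  linarith

section AlgHomAdicCompletion

variable {K L : Type*} [Field K] [NumberField K] [Field L] [NumberField L] [Algebra K L]
  {v : HeightOneSpectrum (𝓞 K)}

theorem exists_valued_sub_algebraMap_lt (y : v.adicCompletion K) {γ : v.adicCompletion K}
    (hγ : γ ≠ 0) : ∃ k : K, Valued.v (y - algebraMap K _ k) < Valued.v γ := by
  have hopen : IsOpen {z | Valued.v (γ⁻¹ * (y - z)) < 1} := by
    simpa [Valuation.restrict_lt_one_iff] using (Valued.isOpen_ball (v.adicCompletion K) 1).preimage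
      (f := fun z ↦ γ⁻¹ * (y - z)) (by fun_prop)
  obtain ⟨k, hk⟩ := (denseRange_algebraMap (R := 𝓞 K) K v).exists_mem_open hopen ⟨y, by simp⟩
  refine ⟨k, ?_⟩
  have hγ' : 0 < Valued.v γ := by simpa [zero_lt_iff] using hγ
  have : Valued.v γ⁻¹ * Valued.v (y - algebraMap K _ k) < 1 := by simpa using hk
  rwa [map_inv₀, inv_mul_lt_one₀ hγ'] at this

theorem valued_algebraMap_adicCompletion (k : K) :
    Valued.v (algebraMap K (v.adicCompletion K) k) = v.valuation K k :=
  valuedAdicCompletion_eq_valuation' v k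

omit [NumberField L] in
theorem valued_algHom_le_one (φ : L →ₐ[K] v.adicCompletion K) (z : 𝓞 L) :
    Valued.v (φ z) ≤ 1 := by
  have hz : IsIntegral ℤ (φ z) := (RingOfIntegers.isIntegral_coe z).map (φ.restrictScalars ℤ)
  exact (adicCompletionIntegers.integers K v).mem_of_integral hz.tower_top

/-- The prime of `L` above `v` cut out by a `K`-embedding of `L` into `K_v`. -/
def primeOfAlgHom (φ : L →ₐ[K] v.adicCompletion K) : HeightOneSpectrum (𝓞 L) where
  asIdeal :=
    { carrier := {z | Valued.v (φ z) < 1}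
      add_mem' := fun {a b} ha hb ↦ by
        simpa using Valued.v.map_add_lt ha hb
      zero_mem' := by simp
      smul_mem' := fun c z hz ↦ by
        simpa using mul_lt_one_of_nonneg_of_lt_one_right (valued_algHom_le_one φ c) zero_le hz }
  isPrime := by
    refine Ideal.isPrime_iff.mpr ⟨fun h ↦ ?_, fun {a b} hab ↦ ?_⟩
    · have : (1 : 𝓞 L) ∈ ({z | Valued.v (φ z) < 1} : Set (𝓞 L)) := (Ideal.eq_top_iff_one _).mp h
      simp at this
    · by_contra! h
      have ha : Valued.v (φ a) = 1 := (valued_algHom_le_one φ a).antisymm (not_lt.mp h.1)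
      have hb : Valued.v (φ b) = 1 := (valued_algHom_le_one φ b).antisymm (not_lt.mp h.2)
      have : Valued.v (φ (a * b : 𝓞 L)) < 1 := hab
      simp [ha, hb] at this
  ne_bot := fun h ↦ by
    obtain ⟨a, ha, ha0⟩ := Submodule.exists_mem_ne_zero_of_ne_bot v.ne_bot
    have hmem : algebraMap (𝓞 K) (𝓞 L) a ∈ ({z | Valued.v (φ z) < 1} : Set (𝓞 L)) := by
      have : φ (algebraMap (𝓞 K) (𝓞 L) a) = algebraMap K _ (a : K) := φ.commutes a
      simpa [this, valued_algebraMap_adicCompletion, valuation_lt_one_iff_mem] using ha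
    have hbot : algebraMap (𝓞 K) (𝓞 L) a ∈ (⊥ : Ideal (𝓞 L)) := h ▸ hmem
    exact ha0 ((FaithfulSMul.algebraMap_eq_zero_iff (𝓞 K) (𝓞 L)).mp hbot)

omit [NumberField L] in
theorem mem_primeOfAlgHom {φ : L →ₐ[K] v.adicCompletion K} {z : 𝓞 L} :
    z ∈ (primeOfAlgHom φ).asIdeal ↔ Valued.v (φ z) < 1 := Iff.rfl

omit [NumberField L] in
theorem algebraMap_mem_primeOfAlgHom {φ : L →ₐ[K] v.adicCompletion K} {a : 𝓞 K} :
    algebraMap (𝓞 K) (𝓞 L) a ∈ (primeOfAlgHom φ).asIdeal ↔ a ∈ v.asIdeal := by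
  have : φ (algebraMap (𝓞 K) (𝓞 L) a) = algebraMap K _ (a : K) := φ.commutes a
  rw [mem_primeOfAlgHom, this, valued_algebraMap_adicCompletion, valuation_lt_one_iff_mem]

omit [NumberField L] in
theorem comap_primeOfAlgHom (φ : L →ₐ[K] v.adicCompletion K) :
    (primeOfAlgHom φ).asIdeal.comap (algebraMap (𝓞 K) (𝓞 L)) = v.asIdeal := by
  ext a
  rw [Ideal.mem_comap]
  exact algebraMap_mem_primeOfAlgHom

theorem absNorm_primeOfAlgHom (φ : L →ₐ[K] v.adicCompletion K) :
    Ideal.absNorm (primeOfAlgHom φ).asIdeal = Ideal.absNorm v.asIdeal := by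
  let f := (Ideal.Quotient.mk (primeOfAlgHom φ).asIdeal).comp (algebraMap (𝓞 K) (𝓞 L))
  have hker : RingHom.ker f = v.asIdeal := by
    rw [← comap_primeOfAlgHom φ, ← RingHom.comap_ker, Ideal.mk_ker]
  have hsurj : Function.Surjective f := fun y ↦ by
    obtain ⟨z, rfl⟩ := Ideal.Quotient.mk_surjective y
    obtain ⟨k, hk⟩ := exists_valued_sub_algebraMap_lt (φ z) one_ne_zero
    rw [map_one] at hk
    have hk1 : v.valuation K k ≤ 1 := by
      rw [← valued_algebraMap_adicCompletion, ← sub_sub_self (φ z) (algebraMap K _ k)]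
      exact Valued.v.map_sub_le (valued_algHom_le_one φ z) hk.le
    obtain ⟨a, ha⟩ := exists_valuation_sub_lt_of_integer v hk1 1
    rw [← valued_algebraMap_adicCompletion, map_sub] at ha
    refine ⟨a, (Ideal.Quotient.mk_eq_mk_iff_sub_mem _ _).mpr ?_⟩
    have : φ (algebraMap (𝓞 K) (𝓞 L) a) = algebraMap K _ (a : K) := φ.commutes a
    have hsub (b c : 𝓞 L) : φ (b - c : 𝓞 L) = φ b - φ c :=
      map_sub (φ.toRingHom.comp (algebraMap (𝓞 L) L)) b c
    rw [mem_primeOfAlgHom, hsub, this,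
      ← sub_sub_sub_cancel_right _ _ (algebraMap K _ k)]
    exact Valued.v.map_sub_lt (by simpa using ha) hk
  rw [Ideal.absNorm_apply, Ideal.absNorm_apply, Submodule.cardQuot_apply, Submodule.cardQuot_apply,
    ← hker]
  exact (Nat.card_congr (RingHom.quotientKerEquivOfSurjective hsurj).toEquiv).symm

theorem primeOfAlgHom_ne {φ φ' : L →ₐ[K] v.adicCompletion K} {t : L} {x : K} (ht0 : t ≠ 0)
    (ht : t ^ 2 = algebraMap K L x) (hφ : φ' t = -φ t) :
    primeOfAlgHom φ ≠ primeOfAlgHom φ' := by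
  intro heq
  have hy : φ t ≠ 0 := by simpa using ht0
  have hx0 : x ≠ 0 := by
    rintro rfl
    simp [ht0] at ht
  have h2 : (2 : v.adicCompletion K) ≠ 0 := by
    rw [← map_ofNat (algebraMap K (v.adicCompletion K)) 2]
    simp
  obtain ⟨b, hb⟩ := exists_valued_sub_algebraMap_lt (φ t) (mul_ne_zero h2 hy)
  set z : L := (1 - algebraMap K L b / t) / 2 with hz
  set n : K := (1 - b ^ 2 / x) / 4 with hn
  have hzn : z ^ 2 - z + algebraMap K L n = 0 := by
    have hx0' : algebraMap K L x ≠ 0 := by simpa using hx0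
    have : (4 : L) ≠ 0 := by norm_num
    simp only [hz, hn, map_div₀, map_sub, map_one, map_pow, map_ofNat, ← ht]
    field_simp
    ring
  have hφz : Valued.v (φ z) < 1 := by
    have : φ z = (φ t - algebraMap K _ b) / (2 * φ t) := by
      simp only [hz, map_div₀, map_sub, map_one, map_ofNat, AlgHom.commutes]
      field_simp
    rw [this, map_div₀]
    exact (div_lt_one₀ (by simpa [zero_lt_iff] using ⟨h2, ht0⟩)).mpr hb
  have hsum : φ' z = 1 - φ z := by
    simp only [hz, map_div₀, map_sub, map_one, map_ofNat, AlgHom.commutes, hφ]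
    field_simp
    ring
  have hnv : v.valuation K n ≤ 1 := by
    have : algebraMap K (v.adicCompletion K) n = φ z * (1 - φ z) := by
      have := congrArg φ hzn
      simp only [map_add, map_sub, map_pow, AlgHom.commutes, map_zero] at this
      linear_combination this
    rw [← valued_algebraMap_adicCompletion, this, map_mul]
    exact mul_le_one' hφz.le (Valued.v.map_sub_le (by simp) hφz.le)
  obtain ⟨m, ⟨d, hd⟩, hm⟩ := exists_primeCompl_mul_eq_of_integer v n hnv
  have hint : IsIntegral (𝓞 K) (algebraMap (𝓞 K) L d * z) := by
    refine ⟨.X ^ 2 - .C d * .X + .C (d * m), by monicity!, ?_⟩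
    have hm' : algebraMap K L n * algebraMap (𝓞 K) L d = algebraMap (𝓞 K) L m := by
      rw [IsScalarTower.algebraMap_apply (𝓞 K) K L, IsScalarTower.algebraMap_apply (𝓞 K) K L,
        ← hm, map_mul]
    simp only [Polynomial.eval₂_add, Polynomial.eval₂_sub, Polynomial.eval₂_mul,
      Polynomial.eval₂_C, Polynomial.eval₂_X_pow, Polynomial.eval₂_X, map_mul, ← hm']
    linear_combination (algebraMap (𝓞 K) L d) ^ 2 * hzn
  obtain ⟨w, hw⟩ : ∃ w : 𝓞 L, (w : L) = algebraMap K L d * z :=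
    ⟨⟨_, isIntegral_trans (R := ℤ) _ hint⟩, rfl⟩
  have hdv : Valued.v (algebraMap K (v.adicCompletion K) d) = 1 := by
    rw [valued_algebraMap_adicCompletion]
    exact (valuation_eq_one_iff_notMem v).mpr hd
  have hw1 : w ∈ (primeOfAlgHom φ).asIdeal := by
    rw [mem_primeOfAlgHom, hw]
    simpa [hdv] using hφz
  rw [heq, mem_primeOfAlgHom, hw, map_mul, AlgHom.commutes, map_mul, hdv, one_mul, hsum] at hw1
  have := Valued.v.map_add_lt hw1 hφz
  simp at this

end AlgHomAdicCompletion

open Polynomial in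
theorem isSquare_of_forall_isSquare_adicCompletion {K : Type*} [Field K] [NumberField K] {x : K}
    (hx : ∀ v : HeightOneSpectrum (𝓞 K), IsSquare (algebraMap K (v.adicCompletion K) x)) :
    IsSquare x := by
  by_contra hns
  have hirr : Irreducible (X ^ 2 - C x) :=
    X_pow_sub_C_irreducible_of_prime Nat.prime_two fun b hb ↦ hns ⟨b, by rw [← hb, sq]⟩
  have : Fact (Irreducible (X ^ 2 - C x)) := ⟨hirr⟩
  let L := AdjoinRoot (X ^ 2 - C x)
  have : FiniteDimensional K L := (AdjoinRoot.powerBasis hirr.ne_zero).finite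
  have : NumberField L := .of_module_finite K L
  let t : L := AdjoinRoot.root _
  have ht : t ^ 2 = algebraMap K L x := by
    have := AdjoinRoot.eval₂_root (X ^ 2 - C x)
    rw [eval₂_sub, eval₂_X_pow, eval₂_C, sub_eq_zero] at this
    exact this
  have ht0 : t ≠ 0 := by
    rintro h0
    rw [h0, zero_pow two_ne_zero, eq_comm, map_eq_zero] at ht
    exact hns ⟨0, by simp [ht]⟩
  choose y hy using hx
  have hlift (v : HeightOneSpectrum (𝓞 K)) (w : v.adicCompletion K)
      (hw : algebraMap K _ x = w * w) : ∃ φ : L →ₐ[K] v.adicCompletion K, φ t = w :=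
    ⟨AdjoinRoot.liftAlgHom _ (Algebra.ofId K _) w (by simp [hw, sq]),
      AdjoinRoot.liftAlgHom_root _ _ _ _⟩
  choose φ hφ using fun v ↦ hlift v (y v) (hy v)
  choose φ' hφ' using fun v ↦ hlift v (-y v) (by rw [hy v, neg_mul_neg])
  have hinj {v w : HeightOneSpectrum (𝓞 K)} {f : L →ₐ[K] v.adicCompletion K}
      {g : L →ₐ[K] w.adicCompletion K} (h : primeOfAlgHom f = primeOfAlgHom g) : v = w :=
    HeightOneSpectrum.ext <| by rw [← comap_primeOfAlgHom f, ← comap_primeOfAlgHom g, h]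
  refine not_exists_two_sections (fun v ↦ primeOfAlgHom (φ v)) (fun v ↦ primeOfAlgHom (φ' v))
    (fun _ _ ↦ hinj) (fun _ _ ↦ hinj) (fun v w h ↦ ?_)
    (fun v ↦ absNorm_primeOfAlgHom _) (fun v ↦ absNorm_primeOfAlgHom _)
  obtain rfl := hinj h
  exact primeOfAlgHom_ne ht0 ht (by rw [hφ, hφ']) h

end NumberField

theorem exists_monoidHom_zmod_two_ne_one {G : Type*} [CommGroup G] {x : G} (hx : ¬IsSquare x) :
    ∃ χ : G →* Multiplicative (ZMod 2), χ x ≠ 1 := by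
  let H : Subgroup G := (powMonoidHom 2).range
  let V := Additive (G ⧸ H)
  let _ : Module (ZMod 2) V := AddCommGroup.zmodModule fun y ↦ by
    obtain ⟨g, hg⟩ := QuotientGroup.mk_surjective (Additive.toMul y)
    have : (Additive.toMul y) ^ 2 = 1 := by
      rw [← hg, ← QuotientGroup.mk_pow, QuotientGroup.eq_one_iff]
      exact ⟨g, rfl⟩
    exact this
  have hx' : (Additive.ofMul (x : G ⧸ H) : V) ≠ 0 := by
    intro h
    obtain ⟨y, hy⟩ := (QuotientGroup.eq_one_iff x).mp (show (x : G ⧸ H) = 1 from h)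
    exact hx ⟨y, by rw [← hy, powMonoidHom_apply, sq]⟩
  obtain ⟨φ, hφ⟩ : ∃ φ : Module.Dual (ZMod 2) V, φ (Additive.ofMul (x : G ⧸ H)) ≠ 0 := by
    by_contra! h
    exact hx' ((Module.forall_dual_apply_eq_zero_iff (ZMod 2) _).mp h)
  exact ⟨(AddMonoidHom.toMultiplicativeRight φ.toAddMonoidHom).comp (QuotientGroup.mk' H), hφ⟩

theorem exists_fin_dotProduct_separating {k ι : Type*} [Field k] {r : ℕ} (c : ι → Fin r → k)
    (hc : ∀ d : Fin r → k, (∀ i, c i ⬝ᵥ d = 0) → d = 0) :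
    ∃ i : Fin r → ι, ∀ d : Fin r → k, (∀ j, c (i j) ⬝ᵥ d = 0) → d = 0 := by
  have hspan : ⊤ ≤ Submodule.span k (Set.range c) := by
    by_contra h
    obtain ⟨φ, hφ, hφ'⟩ :=
      Submodule.exists_le_ker_of_lt_top _ (lt_top_iff_ne_top.mpr fun h' ↦ h h'.ge)
    have hdot (y : Fin r → k) : y ⬝ᵥ (fun j ↦ φ (Pi.single j 1)) = φ y := by
      conv_rhs => rw [pi_eq_sum_univ' y]
      simp [dotProduct]
    have h0 := hc (fun j ↦ φ (Pi.single j 1)) fun i ↦ by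
      rw [hdot]
      exact hφ' (Submodule.subset_span ⟨i, rfl⟩)
    exact hφ (LinearMap.ext fun y ↦ by rw [← hdot y, h0]; simp)
  let B := (Module.Basis.ofSpan hspan).reindex
    ((Module.Basis.ofSpan hspan).indexEquiv (Pi.basisFun k (Fin r)))
  have hB (j : Fin r) : ∃ i, c i = B j :=
    Module.Basis.ofSpan_subset hspan <| by simp [B]
  choose i hi using hB
  refine ⟨i, fun d hd ↦ dotProduct_eq_zero _ fun y ↦ ?_⟩
  have : dotProductBilin k k d = 0 := B.ext fun j ↦ by
    simpa [← hi, dotProduct_comm] using hd j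
  exact LinearMap.congr_fun this y

theorem exists_monoidHom_injective {G : Type*} [CommGroup G] {ι : Type*} {A : ι → Type*}
    [∀ i, CommGroup (A i)] (φ : ∀ i, G →* A i)
    (hφ : ∀ x : G, (∀ i, IsSquare (φ i x)) → IsSquare x) {r : ℕ} (u : Fin r → G)
    (hu : ∀ e : Fin r → ℕ, (∀ i, e i ≤ 1) → IsSquare (∏ i, u i ^ e i) → ∀ i, e i = 0) (u₀ : G) :
    ∃ (v : Fin r → ι) (χ : ∀ i, A (v i) →* Multiplicative (ZMod 2)),
      Function.Injective fun (e : Fin r → Fin 2) i ↦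
        Multiplicative.toAdd (χ i (φ (v i) (u₀ * ∏ j, u j ^ (e j : ℕ)))) := by
  let c (p : Σ i, A i →* Multiplicative (ZMod 2)) (j : Fin r) : ZMod 2 :=
    Multiplicative.toAdd (p.2 (φ p.1 (u j)))
  have hprod (p : Σ i, A i →* Multiplicative (ZMod 2)) (d : Fin r → ℕ) :
      Multiplicative.toAdd (p.2 (φ p.1 (∏ j, u j ^ d j))) = c p ⬝ᵥ fun j ↦ (d j : ZMod 2) := by
    simp [c, dotProduct, mul_comm]
  obtain ⟨p, hp⟩ := exists_fin_dotProduct_separating c fun d hd ↦ by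
    have hsq : IsSquare (∏ j, u j ^ (d j).val) := hφ _ fun i ↦ by
      by_contra hns
      obtain ⟨χ, hχ⟩ := exists_monoidHom_zmod_two_ne_one hns
      refine hχ (Multiplicative.toAdd.injective ?_)
      simpa using (hprod ⟨i, χ⟩ fun j ↦ (d j).val).trans (by simpa using hd ⟨i, χ⟩)
    have h0 := hu _ (fun j ↦ Nat.le_of_lt_succ (ZMod.val_lt (d j))) hsq
    exact funext fun j ↦ (ZMod.val_eq_zero _).mp (h0 j)
  refine ⟨fun i ↦ (p i).1, fun i ↦ (p i).2, fun e e' h ↦ ?_⟩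
  have h' (e : Fin r → Fin 2) (i : Fin r) := hprod (p i) fun j ↦ (e j : ℕ)
  have hd := hp (fun j ↦ ((e j : ℕ) : ZMod 2) - ((e' j : ℕ) : ZMod 2)) fun i ↦ by
    have hi := congrFun h i
    simp only [map_mul, toAdd_mul, add_right_inj] at hi
    change c (p i) ⬝ᵥ ((fun j ↦ ((e j : ℕ) : ZMod 2)) - fun j ↦ ((e' j : ℕ) : ZMod 2)) = 0
    rw [dotProduct_sub, ← h' e i, ← h' e' i, sub_eq_zero]
    simpa only using hi
  funext j
  have hj := sub_eq_zero.mp (congrFun hd j)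
  generalize e j = a at hj
  generalize e' j = b at hj
  revert a b
  decide

/-- (Affine local certification.) Let `K` be a number field,
`u₁, …, u_r ∈ Kˣ` multiplicatively independent modulo squares and `u₀ ∈ Kˣ`. Then there are
nonzero primes `v₁, …, v_r` of `𝓞_K` and group homomorphisms `λᵢ : (K_{vᵢ})ˣ → ℤ/2ℤ` such
that `(e₁,…,e_r) ↦ (λᵢ(u₀·u₁^{e₁}⋯u_r^{e_r}))ᵢ` is injective on `{0,1}^r`: the `2^r`
candidates in the affine coset are determined by `r` local bits. -/
theorem stmt_11 (K : Type*) [Field K] [NumberField K] (r : ℕ) (u : Fin r → Kˣ)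
    (hindep : ∀ e : Fin r → ℕ, (∀ i, e i ≤ 1) →
      IsSquare (∏ i, ((u i : K)) ^ (e i)) → ∀ i, e i = 0)
    (u₀ : Kˣ) :
    ∃ (v : Fin r → HeightOneSpectrum (𝓞 K))
      (lam : ∀ i : Fin r, ((v i).adicCompletion K)ˣ →* Multiplicative (ZMod 2)),
      Function.Injective (fun e : Fin r → Fin 2 => fun i : Fin r =>
        Multiplicative.toAdd ((lam i) (Units.map
          (algebraMap K ((v i).adicCompletion K)).toMonoidHom
          (u₀ * ∏ j, (u j) ^ ((e j : ℕ)))))) := by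
  refine exists_monoidHom_injective
    (fun v : HeightOneSpectrum (𝓞 K) ↦
      Units.map (algebraMap K (v.adicCompletion K)).toMonoidHom)
    (fun x hx ↦ ?_) u (fun e he hsq ↦ hindep e he ?_) u₀
  · obtain ⟨y, hy⟩ :=
      NumberField.isSquare_of_forall_isSquare_adicCompletion (x := (x : K)) fun v ↦ by
        simpa using (hx v).map (Units.coeHom _)
    have hy0 : y ≠ 0 := by
      rintro rfl
      simp at hy
    exact ⟨Units.mk0 y hy0, Units.ext hy⟩
  · simpa using hsq.map (Units.coeHom K)
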